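/- Let a(n) satisfy a(0)=1, a(1)=2, a(n)=4a(n-1)-2a(n-2). Then a(n) is even for all n ≥ 1, and a(n) ≡ 2 (mod 4) iff ... more simply: 2^{⌈n/2⌉} divides a(n) for all n ≥ 0. -/

import Mathlib

theorem stmt_16 (a : ℕ → ℤ) (h0 : a 0 = 1) (h1 : a 1 = 2)
    (hrec : ∀ n, a (n + 2) = 4 * a (n + 1) - 2 * a n) :
    ∀ n, (2 : ℤ) ^ ((n + 1) / 2) ∣ a n := by
  intro n
  induction n using Nat.twoStepInduction with
  | zero => simp
  | one => simp [h1]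
  | more n ih ih' =>
    have hexp : (n + 2 + 1) / 2 = (n + 1) / 2 + 1 := by omega
    have hle : (n + 1) / 2 ≤ (n + 1 + 1) / 2 := by omega
    rw [hrec, hexp, pow_succ']
    refine dvd_sub ?_ (mul_dvd_mul_left 2 ih)
    exact mul_dvd_mul (by norm_num) ((pow_dvd_pow 2 hle).trans ih')
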